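/- arXiv:1904.00499 — 4 statements merged into one kernel-verified Lean document; each statement's English description precedes it below -/
import Mathlib

section
/- For every integer n > 4, if g_n < p_n (ln p_n + ln ln n − ln ln p_n)/n, then g_n ≤ p_n ((p_n ln n / ln p_n)^{1/n} − 1); that is, the strict bound g_n < p_n (ln p_n + ln ln n − ln ln p_n)/n is a sufficient condition for the Farhadian inequality at index n. -/
open Real

/-- `p n` is the n-th prime, with `p 1 = 2`, `p 2 = 3`, `p 3 = 5`, ... -/
noncomputable def p (n : ℕ) : ℕ := Nat.nth Nat.Prime (n - 1)

/-- `g n = p (n+1) - p n` is the n-th prime gap, as a real number. -/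
noncomputable def g (n : ℕ) : ℝ := (p (n + 1) : ℝ) - (p n : ℝ)
theorem sufficient_farhadian (n : ℕ) (hn : 4 < n)
    (h : g n < (p n : ℝ) * (Real.log (p n) + Real.log (Real.log n) - Real.log (Real.log (p n))) / n) :
    g n ≤ (p n : ℝ) * (((p n : ℝ) * Real.log n / Real.log (p n)) ^ ((1 : ℝ) / n) - 1) := by
  have hp : (p n).Prime := Nat.prime_nth_prime _
  have hp1 : (1 : ℝ) < p n := by exact_mod_cast hp.one_lt
  have hn1 : (1 : ℝ) < n := by exact_mod_cast (by omega : 1 < n)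
  have hp0 : (0 : ℝ) < p n := by linarith
  have hlp : 0 < Real.log (p n) := Real.log_pos hp1
  have hln : 0 < Real.log n := Real.log_pos hn1
  have hpos : 0 < (p n : ℝ) * Real.log n / Real.log (p n) := by positivity
  have hlog : Real.log ((p n : ℝ) * Real.log n / Real.log (p n)) =
      Real.log (p n) + Real.log (Real.log n) - Real.log (Real.log (p n)) := by
    rw [Real.log_div (by positivity) hlp.ne', Real.log_mul hp0.ne' hln.ne']
  rw [Real.rpow_def_of_pos hpos, hlog]
  refine h.le.trans ?_
  rw [mul_div_assoc]
  refine mul_le_mul_of_nonneg_left ?_ hp0.le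
  rw [mul_one_div]
  linarith [Real.add_one_le_exp
    ((Real.log (p n) + Real.log (Real.log n) - Real.log (Real.log (p n))) / (n : ℝ))]
end

section
/- The real function f(x) = (ln(x ln x) − 1)(ln(x ln x) + ln ln x − ln ln(x ln(x ln x))) is monotone increasing on the interval x > 6. -/
open Real

theorem farhadian_bound_monotone :
    MonotoneOn (fun x : ℝ =>
      (Real.log (x * Real.log x) - 1) *
        (Real.log (x * Real.log x) + Real.log (Real.log x) -
          Real.log (Real.log (x * Real.log (x * Real.log x)))))
      (Set.Ioi (6 : ℝ)) := by
  have h6 : (1.69 : ℝ) ≤ Real.log 6 := by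
    have h : Real.log 6 = Real.log 2 + Real.log 3 := by
      rw [← Real.log_mul (by norm_num) (by norm_num)]; norm_num
    have h2 := Real.log_two_gt_d9
    have h3 : 1 ≤ Real.log 3 := by
      rw [Real.le_log_iff_exp_le (by norm_num)]
      have := Real.exp_one_lt_d9
      linarith
    rw [h]; linarith
  -- basic facts
  have key : ∀ x : ℝ, 6 < x → 1.69 ≤ Real.log x ∧ Real.log 3 ≤ Real.log x ∧
      0 ≤ Real.log (Real.log x) ∧
      Real.log (x * Real.log x) = Real.log x + Real.log (Real.log x) ∧
      0.4 ≤ Real.log (Real.log x + Real.log (Real.log x)) ∧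
      Real.log (x * Real.log (x * Real.log x)) =
        Real.log x + Real.log (Real.log x + Real.log (Real.log x)) := by
    intro x hx
    have hL : 1.69 ≤ Real.log x := h6.trans (Real.log_le_log (by norm_num) hx.le)
    have hu : 0 ≤ Real.log (Real.log x) := Real.log_nonneg (by linarith)
    have e1 : Real.log (x * Real.log x) = Real.log x + Real.log (Real.log x) :=
      Real.log_mul (by linarith) (by linarith)
    refine ⟨hL, Real.log_le_log (by norm_num) (by linarith), hu, e1, ?_, ?_⟩
    · have h1 := Real.log_le_log (by norm_num : (0:ℝ) < 1.69)
        (by linarith : (1.69:ℝ) ≤ Real.log x + Real.log (Real.log x))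
      have h2 := Real.one_sub_inv_le_log_of_pos (by norm_num : (0:ℝ) < 1.69)
      norm_num at h1 h2 ⊢
      linarith
    · rw [e1, Real.log_mul (by linarith) (by linarith)]
  intro x hx y hy hxy
  have hx : 6 < x := hx
  have hy : 6 < y := hy
  obtain ⟨hL, hL3, hu, e1, hw, e2⟩ := key x hx
  obtain ⟨hL', -, hu', e1', hw', e2'⟩ := key y hy
  have hLL : Real.log x ≤ Real.log y := Real.log_le_log (by linarith) hxy
  beta_reduce
  rw [e2, e2', e1, e1']
  generalize Real.log x = L at *
  generalize Real.log y = M at *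
  clear e1 e2 e1' e2' key
  have huu : Real.log L ≤ Real.log M := Real.log_le_log (by linarith) hLL
  have hL0 : 0 < L := by linarith
  obtain ⟨r, hr⟩ : ∃ r, r = M / L := ⟨_, rfl⟩
  have hM : M = r * L := by rw [hr]; field_simp
  have hr1 : 1 ≤ r := by rw [hr, le_div_iff₀ hL0]; linarith
  have hlM : Real.log M = Real.log r + Real.log L := by
    rw [hM, Real.log_mul (by linarith) (by linarith)]
  have hlr : Real.log r ≤ r - 1 := Real.log_le_sub_one_of_pos (by linarith)
  have hr2 : Real.log (r ^ 2) = 2 * Real.log r := by simp [Real.log_pow]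
  -- first ratio bound
  have hw2 : Real.log (M + Real.log M) ≤ 2 * Real.log r + Real.log (L + Real.log L) := by
    rw [← hr2, ← Real.log_mul (by positivity) (by linarith)]
    apply Real.log_le_log (by linarith)
    rw [hlM, hM]
    nlinarith [mul_nonneg (sub_nonneg.2 hr1) hu, mul_nonneg (sub_nonneg.2 hr1) (by linarith : 0 ≤ L - 1),
      mul_nonneg (sq_nonneg (r - 1)) hu, mul_nonneg (sq_nonneg (r - 1)) hL0.le]
  have hwu : Real.log (L + Real.log L) ≤ 2 * L := by
    have h1 := Real.log_le_sub_one_of_pos (by linarith : 0 < L + Real.log L)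
    have h2 := Real.log_le_sub_one_of_pos hL0
    linarith
  generalize Real.log (L + Real.log L) = w at *
  generalize Real.log (M + Real.log M) = z at *
  have hv2 : Real.log (M + z) ≤ 2 * Real.log r + Real.log (L + w) := by
    rw [← hr2, ← Real.log_mul (by positivity) (by linarith)]
    apply Real.log_le_log (by linarith)
    have h : 0 ≤ (r - 1) * (r * L + (r + 1) * w - 2) :=
      mul_nonneg (by linarith) (by nlinarith)
    rw [hM]
    nlinarith
  have hv3 : Real.log (L + w) ≤ L + Real.log L := by
    have h1 : Real.log (L + w) ≤ Real.log (3 * L) := Real.log_le_log (by linarith) (by linarith)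
    rw [Real.log_mul (by norm_num) (by linarith)] at h1
    linarith
  apply mul_le_mul <;> linarith
end

section
/- For all integers m ≥ 1 and n ≥ 1, the primes satisfy p_m · p_n > p_{m+n}, and consequently (p_n)^m > p_{nm} for all integers m ≥ 2 and n ≥ 1. -/
open Real

namespace PPB

/-- The primes in `(n, 2 * n]`. -/
def S (n : ℕ) : Finset ℕ := (Finset.Ioc n (2 * n)).filter Nat.Prime

theorem centralBinom_le (n : ℕ) (n_large : 2 < n) :
    n.centralBinom ≤
      (2 * n) ^ (Nat.sqrt (2 * n)) * 4 ^ (2 * n / 3) * (2 * n) ^ (S n).card := by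
  have n_pos : 0 < n := by omega
  have n2_pos : 1 ≤ 2 * n := by omega
  let f x := x ^ n.centralBinom.factorization x
  have f_le : ∀ x, f x ≤ 2 * n := fun x => Nat.pow_factorization_choose_le (by omega)
  let T := (Finset.range (2 * n / 3 + 1)).filter Nat.Prime
  have key : n.centralBinom = (∏ x ∈ T, f x) * ∏ x ∈ S n, f x := by
    have hd : Disjoint T (S n) := by
      rw [Finset.disjoint_left]
      intro x hx hx'
      simp only [T, S, Finset.mem_filter, Finset.mem_range, Finset.mem_Ioc] at hx hx'
      omega
    rw [← Finset.prod_union hd]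
    conv_lhs => rw [← n.prod_pow_factorization_centralBinom]
    symm
    apply Finset.prod_subset
    · intro x hx
      simp only [T, S, Finset.mem_union, Finset.mem_filter, Finset.mem_range,
        Finset.mem_Ioc] at hx ⊢
      omega
    · intro x hx h
      simp only [T, S, Finset.mem_union, Finset.mem_filter, Finset.mem_range,
        Finset.mem_Ioc] at hx h
      by_cases hp : x.Prime
      · have h1 : x ≤ n ∧ 2 * n < 3 * x := by
          simp only [hp, and_true, not_or] at h
          omega
        simp only [f]
        rw [Nat.factorization_centralBinom_of_two_mul_self_lt_three_mul n_large h1.1 h1.2,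
          pow_zero]
      · simp only [f]
        rw [Nat.factorization_eq_zero_of_not_prime _ hp, pow_zero]
  rw [key]
  apply mul_le_mul'
  · rw [← Finset.prod_filter_mul_prod_filter_not T (· ≤ Nat.sqrt (2 * n))]
    apply mul_le_mul'
    · refine (Finset.prod_le_prod' fun p _ => f_le p).trans ?_
      have : (Finset.Icc 1 (Nat.sqrt (2 * n))).card = Nat.sqrt (2 * n) := by
        rw [Nat.card_Icc, Nat.add_sub_cancel]
      rw [Finset.prod_const]
      refine pow_right_mono₀ n2_pos ((Finset.card_le_card fun x hx => ?_).trans this.le)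
      obtain ⟨h1, h2⟩ := Finset.mem_filter.1 hx
      exact Finset.mem_Icc.mpr ⟨(Finset.mem_filter.1 h1).2.one_lt.le, h2⟩
    · refine le_trans ?_ (primorial_le_four_pow (2 * n / 3))
      refine (Finset.prod_le_prod' fun p hp => (?_ : f p ≤ p)).trans ?_
      · obtain ⟨h1, h2⟩ := Finset.mem_filter.1 hp
        refine (pow_right_mono₀ (Finset.mem_filter.1 h1).2.one_lt.le ?_).trans (pow_one p).le
        exact Nat.factorization_choose_le_one (Nat.sqrt_lt'.mp <| not_le.1 h2)
      refine Finset.prod_le_prod_of_subset_of_one_le' (Finset.filter_subset _ _) ?_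
      exact fun p hp _ => (Finset.mem_filter.1 hp).2.one_lt.le
  · refine (Finset.prod_le_prod' fun p _ => f_le p).trans ?_
    rw [Finset.prod_const]

theorem sq_le_two_pow (k : ℕ) : 36 * (k + 14) ^ 2 ≤ 2 ^ (k + 13) := by
  induction k with
  | zero => norm_num
  | succ k ih =>
    rw [show k + 1 + 13 = (k + 13) + 1 by ring, pow_succ 2 (k + 13)]
    have h : 36 * (k + 1 + 14) ^ 2 ≤ 36 * (k + 14) ^ 2 * 2 := by
      have e : 36 * (k + 14) ^ 2 * 2 = 36 * (k + 1 + 14) ^ 2 + 36 * (k ^ 2 + 26 * k + 167) := by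
        ring
      omega
    exact h.trans (Nat.mul_le_mul_right 2 ih)

theorem main_ineq (n : ℕ) (hn : 4096 ≤ n) :
    (2 * n) ^ (2 * Nat.sqrt (2 * n)) * 4 ^ (2 * n / 3) ≤ 4 ^ n := by
  set s := Nat.sqrt (2 * n) with hs
  have hss : s * s ≤ 2 * n := Nat.sqrt_le _
  set l := Nat.log 2 (2 * n) with hl
  have h1 : 2 ^ l ≤ 2 * n := Nat.pow_log_le_self 2 (by omega)
  have h2 : 2 * n < 2 ^ (l + 1) := Nat.lt_pow_succ_log_self (by norm_num) _
  have h3 : 13 ≤ l := by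
    by_contra h
    have : 2 ^ (l + 1) ≤ 2 ^ 13 := Nat.pow_le_pow_right (by norm_num) (by omega)
    norm_num at this
    omega
  obtain ⟨k, hk⟩ := Nat.exists_eq_add_of_le h3
  have h4 := sq_le_two_pow k
  have h5 : 6 * (l + 1) ≤ s := by
    rw [hs, Nat.le_sqrt]
    rw [show k + 13 = l by omega] at h4
    have : k + 14 = l + 1 := by omega
    rw [this] at h4
    nlinarith
  have h6 : 6 * (l + 1) * s ≤ 2 * n := (Nat.mul_le_mul_right s h5).trans hss
  calc (2 * n) ^ (2 * s) * 4 ^ (2 * n / 3)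
      ≤ (2 ^ (l + 1)) ^ (2 * s) * 4 ^ (2 * n / 3) := by gcongr
    _ = 2 ^ ((l + 1) * (2 * s) + 2 * (2 * n / 3)) := by
        rw [← pow_mul, pow_add, show (4 : ℕ) = 2 ^ 2 by norm_num, ← pow_mul]
    _ ≤ 2 ^ (2 * n) := by
        apply Nat.pow_le_pow_right (by norm_num)
        have : 3 * ((l + 1) * (2 * s)) ≤ 2 * n := by nlinarith
        omega
    _ = 4 ^ n := by rw [pow_mul]; norm_num

theorem large_card (n : ℕ) (hn : 4096 ≤ n) : Nat.sqrt (2 * n) ≤ (S n).card := by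
  by_contra! h
  have h1 := Nat.four_pow_lt_mul_centralBinom n (by omega)
  have h2 := centralBinom_le n (by omega)
  have h3 := main_ineq n hn
  set s := Nat.sqrt (2 * n)
  have h4 : n * n.centralBinom ≤ (2 * n) ^ (2 * s) * 4 ^ (2 * n / 3) := by
    calc n * n.centralBinom
        ≤ (2 * n) * ((2 * n) ^ s * 4 ^ (2 * n / 3) * (2 * n) ^ (S n).card) := by
          gcongr; omega
      _ = (2 * n) ^ (s + (S n).card + 1) * 4 ^ (2 * n / 3) := by ring
      _ ≤ _ := by
          gcongr
          · omega
          · omega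
  omega

/-- primes below 100, then a sparse list of primes -/
def L : List ℕ := 
  [2, 3, 5, 7, 11, 13, 17, 19, 23, 29, 31, 37, 41, 43, 47, 53, 59, 61, 67, 71, 73, 79, 83, 89, 97,
  113, 131, 151, 179, 211, 251, 293, 337, 389, 449, 521, 601, 701, 809, 937, 1087, 1259, 1451,
  1669, 1931, 2221, 2557, 2953, 3407, 3919, 4507, 5189, 5981, 6883, 7919]

theorem L_prime : ∀ z ∈ L, z.Prime := by
  unfold L
  simp only [List.forall_mem_cons]
  norm_num

theorem L_nodup : L.Nodup := by decide +kernel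

theorem L_complete : ∀ z < 98, z.Prime → z ∈ L := by
  intro z hz hp
  interval_cases z <;> first | decide | (exfalso; revert hp; norm_num)

theorem L_check : ∀ q ∈ L, ∀ a ∈ L, q ≤ a → q * a ≤ 8191 →
    L.countP (fun z => Nat.ble z q) ≤
      L.countP (fun z => Nat.ble (a + 1) z && Nat.ble (z + 1) (q * a)) := by
  decide +kernel

theorem small_card (q x : ℕ) (hq : q.Prime) (hqx : q ≤ x) (h : q * x ≤ 8191) :
    Nat.count Nat.Prime (q + 1) ≤ ((Finset.Ioo x (q * x)).filter Nat.Prime).card := by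
  have hq91 : q < 91 := by nlinarith
  have hqL : q ∈ L := L_complete q (by omega) hq
  -- the largest element of the list that is at most `x`
  obtain ⟨a, ha, hmax⟩ := Finset.exists_max_image (L.toFinset.filter (· ≤ x)) id
    ⟨q, by simp [hqL, hqx]⟩
  simp only [Finset.mem_filter, List.mem_toFinset, id] at ha hmax
  have hqa : q ≤ a := hmax q ⟨hqL, hqx⟩
  have hax : q * a ≤ q * x := Nat.mul_le_mul_left q ha.2
  have hc := L_check q hqL a ha.1 hqa (hax.trans h)
  have hA : Nat.count Nat.Prime (q + 1) ≤ L.countP (fun z => Nat.ble z q) := by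
    rw [Nat.count_eq_card_filter_range, List.countP_eq_length_filter,
      ← List.toFinset_card_of_nodup (L_nodup.filter _)]
    apply Finset.card_le_card
    intro z hz
    simp only [Finset.mem_filter, Finset.mem_range, List.mem_toFinset, List.mem_filter,
      Nat.ble_eq] at hz ⊢
    exact ⟨L_complete z (by omega) hz.2, by omega⟩
  have hB : L.countP (fun z => Nat.ble (a + 1) z && Nat.ble (z + 1) (q * a)) ≤
      ((Finset.Ioo x (q * x)).filter Nat.Prime).card := by
    rw [List.countP_eq_length_filter, ← List.toFinset_card_of_nodup (L_nodup.filter _)]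
    apply Finset.card_le_card
    intro z hz
    simp only [Finset.mem_filter, Finset.mem_Ioo, List.mem_toFinset, List.mem_filter,
      Nat.ble_eq, Bool.and_eq_true] at hz ⊢
    have hzx : x < z := by
      by_contra hzx
      have := hmax z ⟨hz.1, by omega⟩
      omega
    exact ⟨⟨hzx, by omega⟩, L_prime z hz.1⟩
  exact hA.trans (hc.trans hB)

theorem card_all (i j : ℕ) (hij : i ≤ j) :
    i + 1 ≤ ((Finset.Ioo (Nat.nth Nat.Prime j)
      (Nat.nth Nat.Prime i * Nat.nth Nat.Prime j)).filter Nat.Prime).card := by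
  have hq := Nat.prime_nth_prime i
  have hx := Nat.prime_nth_prime j
  have hqx : Nat.nth Nat.Prime i ≤ Nat.nth Nat.Prime j :=
    Nat.nth_monotone Nat.infinite_setOfPred_prime hij
  have hci : Nat.count Nat.Prime (Nat.nth Nat.Prime i + 1) = i + 1 :=
    Nat.count_nth_succ_of_infinite Nat.infinite_setOfPred_prime i
  have hi := Nat.add_two_le_nth_prime i
  set q := Nat.nth Nat.Prime i
  set x := Nat.nth Nat.Prime j
  by_cases h : q * x ≤ 8191
  · exact hci ▸ small_card q x hq hqx h
  · set n := q * x / 2 with hn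
    have h1 := large_card n (by omega)
    have h2 : i + 1 ≤ Nat.sqrt (2 * n) := by
      rw [Nat.le_sqrt]
      have : (i + 2) * (i + 2) ≤ q * x := Nat.mul_le_mul hi (hi.trans hqx)
      have : (i + 1) * (i + 1) + 1 ≤ q * x := by nlinarith
      omega
    refine h2.trans (h1.trans (Finset.card_le_card ?_))
    intro z hz
    simp only [S, Finset.mem_filter, Finset.mem_Ioc, Finset.mem_Ioo] at hz ⊢
    have h3 : 2 * x ≤ q * x := Nat.mul_le_mul_right x hq.two_le
    refine ⟨⟨by omega, lt_of_le_of_ne (by omega) ?_⟩, hz.2⟩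
    rintro rfl
    exact Nat.not_prime_mul hq.one_lt.ne' hx.one_lt.ne' hz.2

theorem nth_lt (i j : ℕ) (hij : i ≤ j) :
    Nat.nth Nat.Prime (i + j + 1) < Nat.nth Nat.Prime i * Nat.nth Nat.Prime j := by
  apply Nat.nth_lt_of_lt_count
  have h := card_all i j hij
  have hcj : Nat.count Nat.Prime (Nat.nth Nat.Prime j + 1) = j + 1 :=
    Nat.count_nth_succ_of_infinite Nat.infinite_setOfPred_prime j
  have hq := (Nat.prime_nth_prime i).two_le
  have hx := (Nat.prime_nth_prime j).two_le
  set q := Nat.nth Nat.Prime i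
  set x := Nat.nth Nat.Prime j
  have h3 : 2 * x ≤ q * x := Nat.mul_le_mul_right x hq
  have e1 : Nat.count Nat.Prime (x + 1) = ((Finset.range (x + 1)).filter Nat.Prime).card :=
    Nat.count_eq_card_filter_range _ _
  have e2 : Nat.count Nat.Prime (q * x) = ((Finset.range (q * x)).filter Nat.Prime).card :=
    Nat.count_eq_card_filter_range _ _
  rw [e1] at hcj
  rw [e2]
  have hd : Disjoint ((Finset.range (x + 1)).filter Nat.Prime)
      ((Finset.Ioo x (q * x)).filter Nat.Prime) := by
    rw [Finset.disjoint_left]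
    intro z hz hz'
    simp only [Finset.mem_filter, Finset.mem_range, Finset.mem_Ioo] at hz hz'
    omega
  have hle : ((Finset.range (x + 1)).filter Nat.Prime ∪
      (Finset.Ioo x (q * x)).filter Nat.Prime).card ≤
      ((Finset.range (q * x)).filter Nat.Prime).card := by
    apply Finset.card_le_card
    intro z hz
    simp only [Finset.mem_union, Finset.mem_filter, Finset.mem_range, Finset.mem_Ioo] at hz ⊢
    rcases hz with hz | hz
    · exact ⟨by omega, hz.2⟩
    · exact ⟨by omega, hz.2⟩
  rw [Finset.card_union_of_disjoint hd] at hle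
  omega

theorem part_one (m n : ℕ) (hm : 1 ≤ m) (hn : 1 ≤ n) : p m * p n > p (m + n) := by
  obtain ⟨i, rfl⟩ := Nat.exists_eq_add_of_le' hm
  obtain ⟨j, rfl⟩ := Nat.exists_eq_add_of_le' hn
  unfold p
  have e : i + 1 + (j + 1) - 1 = i + j + 1 := by omega
  rw [e, Nat.add_sub_cancel, Nat.add_sub_cancel]
  rcases le_total i j with h | h
  · exact nth_lt i j h
  · rw [mul_comm, add_comm i j]
    exact nth_lt j i h

end PPB

theorem prime_product_bounds :
    (∀ m n : ℕ, 1 ≤ m → 1 ≤ n → p m * p n > p (m + n)) ∧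
      (∀ m n : ℕ, 2 ≤ m → 1 ≤ n → p n ^ m > p (n * m)) := by
  refine ⟨PPB.part_one, ?_⟩
  intro m n hm hn
  induction m, hm using Nat.le_induction with
  | base =>
    rw [pow_two, mul_two]
    exact PPB.part_one n n hn hn
  | succ m hm ih =>
    have hpos : 0 < p n := (Nat.prime_nth_prime (n - 1)).pos
    have h1 := PPB.part_one (n * m) n (Nat.mul_pos hn (by omega)) hn
    rw [pow_succ, mul_add, mul_one]
    calc p (n * m + n) < p (n * m) * p n := h1
      _ ≤ p n ^ m * p n := Nat.mul_le_mul_right _ ih.le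
end

section
/- For all integers n ≥ 1 and m ≥ 2, one has (ln p_n)/n > (ln p_{nm})/(nm). (An averaged form of the Firoozbakht conjecture, valid unconditionally.) -/
open Real

lemma nth_small : ∀ k < 48, 4 ≤ k → k - 1 < Nat.count Nat.Prime (k ^ 2 / 2 + 1) := by
  decide +kernel

/-- Analytic step: the Chebyshev lower bound is incompatible with few primes below `P`. -/
lemma analytic_step (k P : ℕ) (hP : 1152 ≤ P) (hk : k ^ 2 < 2 * P)
    (h : (P : ℝ) * Real.log 2 - Real.log (P + 1) ≤ k * Real.log P) : False := by
  have hP' : (1152 : ℝ) ≤ P := by exact_mod_cast hP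
  have hk' : (k : ℝ) ^ 2 < 2 * P := by exact_mod_cast hk
  obtain ⟨s, hs⟩ : ∃ s, s = Real.sqrt (2 * P) := ⟨_, rfl⟩
  have hss : s ^ 2 = 2 * P := by rw [hs, Real.sq_sqrt (by positivity)]
  have hs0 : 0 ≤ s := by rw [hs]; positivity
  have hs48 : 48 ≤ s := by nlinarith
  have hks : (k : ℝ) ≤ s := by
    rw [hs]; exact Real.le_sqrt_of_sq_le hk'.le
  have h2a := Real.log_two_gt_d9
  have h2b := Real.log_two_lt_d9
  have hlog48 : Real.log s ≤ s / 48 + 3.16 := by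
    have e1 : Real.log s = Real.log (s / 48) + Real.log 48 := by
      rw [Real.log_div (by linarith) (by norm_num)]; ring
    have e2 : Real.log (s / 48) ≤ s / 48 - 1 := Real.log_le_sub_one_of_pos (by linarith)
    have e3 : Real.log 48 ≤ 6 * Real.log 2 := by
      have : Real.log ((2 : ℝ) ^ 6) = 6 * Real.log 2 := by rw [Real.log_pow]; norm_num
      rw [← this]
      exact Real.log_le_log (by norm_num) (by norm_num)
    linarith
  have hl2P : Real.log (2 * P) = 2 * Real.log s := by
    rw [← hss, Real.log_pow]; norm_num
  have hlP : Real.log P = 2 * Real.log s - Real.log 2 := by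
    rw [← hl2P, Real.log_mul (by norm_num) (by linarith)]; ring
  have hlP1 : Real.log (P + 1) ≤ 2 * Real.log s := by
    rw [← hl2P]; exact Real.log_le_log (by linarith) (by linarith)
  have hlP0 : 0 ≤ Real.log P := Real.log_nonneg (by linarith)
  have a1 : (k : ℝ) * Real.log P ≤ s * (s / 24 + 5.7) :=
    mul_le_mul hks (by linarith) hlP0 hs0
  have a2 : (P : ℝ) * 0.69 ≤ P * Real.log 2 :=
    mul_le_mul_of_nonneg_left (by linarith) (by linarith)
  nlinarith

/-- `2 p_k ≤ k²` for `k ≥ 4`. -/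
lemma two_mul_nth_le (k : ℕ) (hk : 4 ≤ k) : 2 * Nat.nth Nat.Prime (k - 1) ≤ k ^ 2 := by
  by_cases h48 : k < 48
  · have := Nat.nth_lt_of_lt_count (nth_small k h48 hk)
    omega
  · push Not at h48
    by_contra! hlt
    have hc : Nat.primeCounting (Nat.nth Nat.Prime (k - 1)) = k := by
      have := Nat.count_nth_succ_of_infinite Nat.infinite_setOfPred_prime (k - 1)
      rw [Nat.primeCounting, Nat.primeCounting', this]
      omega
    have h1 := Chebyshev.psi_ge (Nat.nth Nat.Prime (k - 1))
    have h2 := Chebyshev.psi_le_primeCounting_mul_log (Nat.nth Nat.Prime (k - 1))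
    rw [hc] at h2
    exact analytic_step k _ (by nlinarith) hlt (h1.trans h2)

lemma le_nth_prime (n : ℕ) : 2 * n + 3 ≤ Nat.nth Nat.Prime (n + 1) := by
  induction n with
  | zero => simp
  | succ n ih =>
    have h1 : Nat.nth Nat.Prime (n + 1) < Nat.nth Nat.Prime (n + 1 + 1) :=
      Nat.nth_strictMono Nat.infinite_setOfPred_prime (Nat.lt_succ_self _)
    have o1 := (Nat.prime_nth_prime (n + 1)).eq_two_or_odd
    have o2 := (Nat.prime_nth_prime (n + 1 + 1)).eq_two_or_odd
    omega

lemma growth (a m : ℕ) (ha : 2 ≤ a) (hm : 2 ≤ m) : (a * m) ^ 2 < 2 * (2 * a - 1) ^ m := by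
  obtain ⟨b, rfl⟩ : ∃ b, a = b + 2 := ⟨a - 2, by omega⟩
  have e : 2 * (b + 2) - 1 = 2 * b + 3 := by omega
  rw [e]
  induction m, hm using Nat.le_induction with
  | base => nlinarith
  | succ m hm ih =>
    have h1 : ((b + 2) * (m + 1)) ^ 2 ≤ 3 * ((b + 2) * m) ^ 2 := by
      have : (m + 1) ^ 2 ≤ 3 * m ^ 2 := by nlinarith
      calc ((b + 2) * (m + 1)) ^ 2 = (b + 2) ^ 2 * (m + 1) ^ 2 := by ring
        _ ≤ (b + 2) ^ 2 * (3 * m ^ 2) := Nat.mul_le_mul_left _ this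
        _ = _ := by ring
    rw [pow_succ (2 * b + 3) m]
    nlinarith [Nat.zero_le (b * (2 * b + 3) ^ m)]

lemma growth_two (m : ℕ) (hm : 4 ≤ m) : m ^ 2 < 2 * 2 ^ m := by
  induction m, hm using Nat.le_induction with
  | base => norm_num
  | succ m hm ih =>
    rw [pow_succ 2 m]
    nlinarith

lemma nth_mul_lt (n m : ℕ) (hn : 1 ≤ n) (hm : 2 ≤ m) :
    Nat.nth Nat.Prime (n * m - 1) < Nat.nth Nat.Prime (n - 1) ^ m := by
  rcases Nat.lt_or_ge n 2 with h | h
  · obtain rfl : n = 1 := by omega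
    simp only [one_mul, Nat.sub_self, Nat.nth_prime_zero_eq_two]
    rcases Nat.lt_or_ge m 4 with h4 | h4
    · interval_cases m
      · simp
      · simp
    · have := two_mul_nth_le m h4
      have := growth_two m h4
      omega
  · have h1 := two_mul_nth_le (n * m) (by nlinarith)
    have h2 := growth n m h hm
    have h3 : 2 * n - 1 ≤ Nat.nth Nat.Prime (n - 1) := by
      have := le_nth_prime (n - 2)
      rw [show n - 2 + 1 = n - 1 by omega] at this
      omega
    have h4 := Nat.pow_le_pow_left h3 m
    omega

theorem averaged_firoozbakht (n m : ℕ) (hn : 1 ≤ n) (hm : 2 ≤ m) :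
    Real.log (p n) / n > Real.log (p (n * m)) / (n * m) := by
  have key : p (n * m) < p n ^ m := nth_mul_lt n m hn hm
  have hpos : 0 < p (n * m) := (Nat.prime_nth_prime _).pos
  have hn' : (0 : ℝ) < n := by exact_mod_cast hn
  have hm' : (0 : ℝ) < m := by exact_mod_cast (by omega : 0 < m)
  have hl : Real.log (p (n * m)) < m * Real.log (p n) := by
    rw [← Real.log_pow]
    exact Real.log_lt_log (by exact_mod_cast hpos) (by exact_mod_cast key)
  rw [gt_iff_lt, div_lt_div_iff₀ (by positivity) hn']
  nlinarith
end
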